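/- arXiv:2109.04615 — 4 statements merged into one kernel-verified Lean document; each statement's English description precedes it below -/
import Mathlib

section
/- Let a < b be real numbers, σ > 0, and let f : ℝ → ℝ be twice differentiable on [a, b] with f''(p) ≤ −σ² for all p ∈ [a, b]. Suppose p* ∈ [a, b] satisfies f'(p*) = 0. Define the quadrisection points ρ_k = a + (k−1)(b−a)/4 for k = 1,…,5, and let δ = b − a. Then: (i) if p* ≥ ρ_3, then min{ f(ρ_2) − f(ρ_1), f(ρ_3) − f(ρ_2) } ≥ σ² δ² / 32; and (ii) if p* ≤ ρ_3, then min{ f(ρ_3) − f(ρ_4), f(ρ_4) − f(ρ_5) } ≥ σ² δ² / 32. (This is the key quadrisection-search dichotomy used in the regret analyses of the CPPQ and LPPQ algorithms: for a σ²-strongly-concave revenue curve with interior maximizer, at least one of the two triples of quadrisection points exhibits a revenue gap of order σ²δ².) -/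
open Set

/-- If `f''` is bounded above by `-c` on `[a, b]` and `f'` vanishes at `p`, then adding the
quadratic `c / 2 * (x - p) ^ 2` to `f` yields a function which still increases on `[a, p]` and
decreases on `[p, b]`. -/
theorem monotoneOn_antitoneOn_add_sq_of_deriv2_le {a b c p : ℝ} {f f' f'' : ℝ → ℝ}
    (hf' : ∀ x ∈ Icc a b, HasDerivWithinAt f (f' x) (Icc a b) x)
    (hf'' : ∀ x ∈ Icc a b, HasDerivWithinAt f' (f'' x) (Icc a b) x)
    (hc : ∀ x ∈ Icc a b, f'' x ≤ -c) (hp : p ∈ Icc a b) (hstat : f' p = 0) :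
    MonotoneOn (fun x => f x + c / 2 * (x - p) ^ 2) (Icc a p) ∧
      AntitoneOn (fun x => f x + c / 2 * (x - p) ^ 2) (Icc p b) := by
  have hg : ∀ x ∈ Icc a b, HasDerivWithinAt (fun x => f' x + c * (x - p)) (f'' x + c)
      (Icc a b) x := fun x hx =>
    ((hf'' x hx).add (((hasDerivWithinAt_id x _).sub_const p).const_mul c)).congr_deriv
      (by ring)
  have hh : ∀ x ∈ Icc a b, HasDerivWithinAt (fun x => f x + c / 2 * (x - p) ^ 2)
      (f' x + c * (x - p)) (Icc a b) x := fun x hx =>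
    ((hf' x hx).add
      ((((hasDerivWithinAt_id x _).sub_const p).pow 2).const_mul (c / 2))).congr_deriv
      (by simp; ring)
  have hanti : AntitoneOn (fun x => f' x + c * (x - p)) (Icc a b) :=
    antitoneOn_of_hasDerivWithinAt_nonpos (convex_Icc a b)
      (fun x hx => (hg x hx).continuousWithinAt)
      (fun x hx => (hg x (interior_subset hx)).mono interior_subset)
      (fun x hx => by linarith [hc x (interior_subset hx)])
  have hl : Icc a p ⊆ Icc a b := Icc_subset_Icc_right hp.2
  have hr : Icc p b ⊆ Icc a b := Icc_subset_Icc_left hp.1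
  constructor
  · refine monotoneOn_of_hasDerivWithinAt_nonneg (convex_Icc a p)
      (fun x hx => ((hh x (hl hx)).mono hl).continuousWithinAt)
      (fun x hx => (hh x (hl (interior_subset hx))).mono (interior_subset.trans hl))
      (fun x hx => ?_)
    have hx := interior_subset hx
    simpa [hstat] using hanti (hl hx) hp hx.2
  · refine antitoneOn_of_hasDerivWithinAt_nonpos (convex_Icc p b)
      (fun x hx => ((hh x (hr hx)).mono hr).continuousWithinAt)
      (fun x hx => (hh x (hr (interior_subset hx))).mono (interior_subset.trans hr))
      (fun x hx => ?_)
    have hx := interior_subset hx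
    simpa [hstat] using hanti hp (hr hx) hx.1

/-- the quadrisection-search dichotomy of the CPPQ/LPPQ regret analyses:
for a `σ²`-strongly-concave function on `[a,b]` with interior stationary point `p*`,
at least one of the two triples of quadrisection points exhibits a gap of order `σ²δ²`. -/
theorem quadrisection_dichotomy (a b σ : ℝ) (hab : a < b) (hσ : 0 < σ)
    (f f' f'' : ℝ → ℝ)
    (hf' : ∀ x ∈ Icc a b, HasDerivWithinAt f (f' x) (Icc a b) x)
    (hf'' : ∀ x ∈ Icc a b, HasDerivWithinAt f' (f'' x) (Icc a b) x)
    (hconc : ∀ x ∈ Icc a b, f'' x ≤ -σ ^ 2)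
    (pstar : ℝ) (hmem : pstar ∈ Icc a b) (hstat : f' pstar = 0)
    (ρ : Fin 5 → ℝ) (hρ : ∀ k : Fin 5, ρ k = a + (k : ℝ) * (b - a) / 4) :
    (ρ 2 ≤ pstar →
      min (f (ρ 1) - f (ρ 0)) (f (ρ 2) - f (ρ 1)) ≥ σ ^ 2 * (b - a) ^ 2 / 32) ∧
    (pstar ≤ ρ 2 →
      min (f (ρ 2) - f (ρ 3)) (f (ρ 3) - f (ρ 4)) ≥ σ ^ 2 * (b - a) ^ 2 / 32) := by
  obtain ⟨hmono, hanti⟩ := monotoneOn_antitoneOn_add_sq_of_deriv2_le hf' hf''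
    hconc hmem hstat
  have h0 : ρ 0 = a := by simp [hρ]
  have h1 : ρ 1 = a + (b - a) / 4 := by simp [hρ]
  have h2 : ρ 2 = a + (b - a) / 2 := by rw [hρ]; norm_num; ring
  have h3 : ρ 3 = a + 3 * (b - a) / 4 := by rw [hρ]; norm_num
  have h4 : ρ 4 = b := by rw [hρ]; norm_num
  have hδ : 0 < b - a := sub_pos.2 hab
  constructor
  · intro hp
    have key : 0 ≤ σ ^ 2 * ((b - a) * (pstar - ρ 2)) :=
      mul_nonneg (sq_nonneg σ) (mul_nonneg hδ.le (sub_nonneg.2 hp))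
    have h01 := @hmono (ρ 0) ⟨by linarith, by linarith⟩ (ρ 1) ⟨by linarith, by linarith⟩
      (by linarith)
    have h12 := @hmono (ρ 1) ⟨by linarith, by linarith⟩ (ρ 2) ⟨by linarith, by linarith⟩
      (by linarith)
    simp only [h0, h1, h2] at *
    exact le_min (by nlinarith) (by nlinarith)
  · intro hp
    have key : 0 ≤ σ ^ 2 * ((b - a) * (ρ 2 - pstar)) :=
      mul_nonneg (sq_nonneg σ) (mul_nonneg hδ.le (sub_nonneg.2 hp))
    have h23 := @hanti (ρ 2) ⟨by linarith, by linarith⟩ (ρ 3) ⟨by linarith, by linarith⟩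
      (by linarith)
    have h34 := @hanti (ρ 3) ⟨by linarith, by linarith⟩ (ρ 4) ⟨by linarith, by linarith⟩
      (by linarith)
    simp only [h2, h3, h4] at *
    exact le_min (by nlinarith) (by nlinarith)
end

section
/- For c ≥ 0 define f_c(p) = p · (2/3 − p/2 + c(1/3 − p/2)) and p*_c = (2 + c)/(3(1 + c)). Let 0 < δ ≤ 1. Then: (i) if c ≥ δ and p ≥ 2/3 − δ/12, then f_c(p*_c) − f_c(p) ≥ δ²/288; and (ii) if c = 0 and p ≤ 2/3 − δ/12, then f_0(2/3) − f_0(p) ≥ δ²/288. (This is the payoff-separation step in the proof of Lemma 3 of the paper: under the constructed instances, offering a price in the region A = {p ≥ 2/3 − ηh/12} when ν_j = 1 with d(x,∂B_j) ≥ ηh, or a price in the region B = {p ≤ 2/3 − ηh/12} when ν_j = 0, incurs an instantaneous revenue loss of order (ηh)², which converts low regret into accurate classification of the bits ν_j.) -/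
/-- payoff-separation step in the proof of Lemma 3 of the paper: for
the revenue function `f_c(p) = p(2/3 − p/2 + c(1/3 − p/2))` with maximizer
`p*_c = (2+c)/(3(1+c))`, (i) if `c ≥ δ` and `p ≥ 2/3 − δ/12` then
`f_c(p*_c) − f_c(p) ≥ δ²/288`, and (ii) if `c = 0` and `p ≤ 2/3 − δ/12` then
`f_0(2/3) − f_0(p) ≥ δ²/288`. -/
theorem payoff_separation (δ : ℝ) (hδ0 : 0 < δ) (hδ1 : δ ≤ 1) :
    let f : ℝ → ℝ → ℝ := fun c p => p * (2 / 3 - p / 2 + c * (1 / 3 - p / 2))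
    let pstar : ℝ → ℝ := fun c => (2 + c) / (3 * (1 + c))
    (∀ c p : ℝ, 0 ≤ c → δ ≤ c → 2 / 3 - δ / 12 ≤ p →
        f c (pstar c) - f c p ≥ δ ^ 2 / 288) ∧
    (∀ p : ℝ, p ≤ 2 / 3 - δ / 12 → f 0 (2 / 3) - f 0 p ≥ δ ^ 2 / 288) := by
  intro f pstar
  refine ⟨fun c p hc hδc hp => ?_, fun p hp => ?_⟩
  · have h1 : 0 < 1 + c := by linarith
    have hgap : f c (pstar c) - f c p = (1 + c) / 2 * (p - pstar c) ^ 2 := by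
      simp only [f, pstar]
      field_simp
      ring
    have hstar : pstar c ≤ 2 / 3 - δ / 6 := by
      simp only [pstar]
      rw [div_le_iff₀ (by positivity)]
      nlinarith [mul_nonneg hc (sub_nonneg.mpr hδ1)]
    have hsq : (δ / 12) ^ 2 ≤ (p - pstar c) ^ 2 :=
      pow_le_pow_left₀ (by positivity) (by linarith) 2
    rw [hgap]
    nlinarith [mul_nonneg hc (sq_nonneg (p - pstar c))]
  · have hgap : f 0 (2 / 3) - f 0 p = (2 / 3 - p) ^ 2 / 2 := by
      simp only [f]
      ring
    have hsq : (δ / 12) ^ 2 ≤ (2 / 3 - p) ^ 2 :=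
      pow_le_pow_left₀ (by positivity) (by linarith) 2
    rw [hgap]
    linarith
end

section
/- Let p, p₀ ∈ ℝ and h > 0. Then inf over all p' ∈ ℝ with |p' − p₀| ≤ h/12 of (p − p')² is at least (1/4) · φ((p − p₀)², h²), where φ(x, δ) = x · 1{x ≥ δ} is the hard-thresholding operator. (This is the key pointwise inequality in the proof of Lemma 6 (regret-self-bound) of the paper: since every optimal price p*(x) of the constructed instances satisfies |p*(x) − p₀| ≤ h/12 with p₀ = 2/3, the squared distance of an offered price p to the optimum is at least a quarter of the hard-thresholded squared distance of p to p₀.) -/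
/-- key pointwise inequality in the proof of Lemma 6 of the paper:
the infimum over `p'` with `|p' − p₀| ≤ h/12` of `(p − p')²` is at least a quarter of
the hard-thresholded squared distance `φ((p − p₀)², h²)`, where
`φ(x, δ) = x · 1{x ≥ δ}`. -/
theorem hard_threshold_lower_bound (p p₀ h : ℝ) (hh : 0 < h) :
    1 / 4 * (if h ^ 2 ≤ (p - p₀) ^ 2 then (p - p₀) ^ 2 else 0)
      ≤ sInf {d : ℝ | ∃ p' : ℝ, |p' - p₀| ≤ h / 12 ∧ d = (p - p') ^ 2} := by
  refine le_csInf ⟨(p - p₀) ^ 2, p₀, by simp; positivity, rfl⟩ ?_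
  rintro d ⟨p', hp', rfl⟩
  split_ifs with hthr
  · have hfar : h ≤ |p - p₀| := by simpa [abs_of_pos hh] using sq_le_sq.mp hthr
    have htri : |p - p₀| ≤ |p - p'| + |p' - p₀| := abs_sub_le p p' p₀
    have hhalf : |p - p₀| / 2 ≤ |p - p'| := by linarith
    calc 1 / 4 * (p - p₀) ^ 2 = (|p - p₀| / 2) ^ 2 := by rw [div_pow, sq_abs]; ring
      _ ≤ |p - p'| ^ 2 := by gcongr
      _ = (p - p') ^ 2 := sq_abs _
  · simpa using sq_nonneg (p - p')
end

section
/- Let ε > 0. Let S and Z be measurable spaces, λ a σ-finite measure on Z, and q : S × Z → (0, ∞) a measurable function with ∫ q(s, z) dλ(z) = 1 for every s ∈ S. Suppose there exists a measurable function m⁰ : Z → (0, ∞) with ∫ m⁰ dλ ≤ 1 such that m⁰(z) ≤ q(s, z) ≤ e^{2ε} m⁰(z) for all s ∈ S and z ∈ Z. Let P₊ and P₋ be probability measures on S and define the output densities m₊(z) = ∫ q(s, z) dP₊(s) and m₋(z) = ∫ q(s, z) dP₋(s). Then the symmetric KL divergence between the output distributions satisfies ∫ (m₊(z) − m₋(z))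 ln( m₊(z)/m₋(z) ) dλ(z) ≤ 4 (e^{2ε} − 1)² · ‖P₊ − P₋‖_TV², where ‖P₊ − P₋‖_TV = sup over measurable A ⊆ S of |P₊(A) − P₋(A)|. (This is the single-time-step strong data processing inequality established inside Lemma 4 of the paper for 2ε-locally-differentially-private channels: privatization contracts the symmetric KL divergence of the input mixtures by a factor (e^{2ε} − 1)², which drives the minimax lower bound of Theorem 3.) -/
open MeasureTheory
open scoped ENNReal

/-- The total variation supremum bounds the difference of the two measures on each event. -/
lemma abs_measure_sub_le_iSup {S : Type*} [MeasurableSpace S] (P Q : Measure S)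
    [IsProbabilityMeasure P] [IsProbabilityMeasure Q] {A : Set S} (hA : MeasurableSet A) :
    |P.real A - Q.real A| ≤
      ⨆ A : {A : Set S // MeasurableSet A}, |(P A).toReal - (Q A).toReal| := by
  refine le_ciSup (f := fun A : {A : Set S // MeasurableSet A} ↦
    |(P A).toReal - (Q A).toReal|) ⟨1, ?_⟩ ⟨A, hA⟩
  rintro _ ⟨B, rfl⟩
  have h1 : P.real B ≤ 1 := measureReal_le_one
  have h2 : Q.real B ≤ 1 := measureReal_le_one
  have h3 : 0 ≤ P.real B := measureReal_nonneg
  have h4 : 0 ≤ Q.real B := measureReal_nonneg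
  change |P.real B - Q.real B| ≤ 1
  rw [abs_le]
  constructor <;> linarith

/-- A function with values in `[0, M]` has expectations under two probability measures
that differ by at most `M` times their total variation distance. -/
lemma abs_integral_sub_le_mul_iSup {S : Type*} [MeasurableSpace S] (P Q : Measure S)
    [IsProbabilityMeasure P] [IsProbabilityMeasure Q] {f : S → ℝ} (hf : Measurable f)
    {M : ℝ} (hM : 0 ≤ M) (hf0 : ∀ s, 0 ≤ f s) (hfM : ∀ s, f s ≤ M) :
    |∫ s, f s ∂P - ∫ s, f s ∂Q| ≤
      M * ⨆ A : {A : Set S // MeasurableSet A}, |(P A).toReal - (Q A).toReal| := by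
  have hint (μ : Measure S) [IsProbabilityMeasure μ] : Integrable f μ :=
    Integrable.of_bound hf.aestronglyMeasurable M
      (.of_forall fun s ↦ by rw [Real.norm_of_nonneg (hf0 s)]; exact hfM s)
  have hcake (μ : Measure S) [IsProbabilityMeasure μ] :
      ∫ s, f s ∂μ = ∫ t in (0 : ℝ)..M, μ.real {s | t ≤ f s} := by
    rw [(hint μ).integral_eq_integral_Ioc_meas_le (.of_forall hf0) (.of_forall hfM),
      intervalIntegral.integral_of_le hM]
  have hii (μ : Measure S) [IsProbabilityMeasure μ] :
      IntervalIntegrable (fun t ↦ μ.real {s | t ≤ f s}) volume 0 M :=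
    Antitone.intervalIntegrable fun t u htu ↦
      measureReal_mono fun s (hs : u ≤ f s) ↦ htu.trans hs
  rw [hcake P, hcake Q, ← intervalIntegral.integral_sub (hii P) (hii Q), ← Real.norm_eq_abs]
  refine (intervalIntegral.norm_integral_le_of_norm_le_const fun t _ ↦
    abs_measure_sub_le_iSup P Q (measurableSet_le measurable_const hf)).trans ?_
  rw [sub_zero, abs_of_nonneg hM, mul_comm]

lemma sub_mul_log_div_le {a b m : ℝ} (hm : 0 < m) (ha : m ≤ a) (hb : m ≤ b) :
    (a - b) * Real.log (a / b) ≤ (a - b) ^ 2 / m := by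
  wlog hab : b ≤ a generalizing a b
  · have h := this hb ha (le_of_not_ge hab)
    rw [← inv_div, Real.log_inv] at h
    rw [← neg_sub b a, neg_sq]
    linarith
  have hb0 : 0 < b := hm.trans_le hb
  have hlog : Real.log (a / b) ≤ (a - b) / m := by
    calc Real.log (a / b) ≤ a / b - 1 :=
          Real.log_le_sub_one_of_pos (div_pos (hm.trans_le ha) hb0)
      _ = (a - b) / b := by field_simp
      _ ≤ (a - b) / m := div_le_div_of_nonneg_left (sub_nonneg.2 hab) hm hb
  calc (a - b) * Real.log (a / b) ≤ (a - b) * ((a - b) / m) :=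
        mul_le_mul_of_nonneg_left hlog (sub_nonneg.2 hab)
    _ = (a - b) ^ 2 / m := by ring

/-- single-time-step strong data processing inequality inside Lemma 4
of the paper: if the channel `q` is `2ε`-locally-differentially-private, i.e. there is
`m⁰` with `∫ m⁰ dλ ≤ 1` and `m⁰ ≤ q(s,·) ≤ e^{2ε} m⁰` for all `s`, then the symmetric
KL divergence between the output densities `m₊, m₋` of two input mixtures `P₊, P₋` is
at most `4 (e^{2ε} − 1)² ‖P₊ − P₋‖²_TV`. -/
theorem strong_data_processing_inequality {S Z : Type*} [MeasurableSpace S] [MeasurableSpace Z]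
    (ε : ℝ) (hε : 0 < ε)
    (lam : Measure Z) [SigmaFinite lam]
    (q : S → Z → ℝ) (hq_meas : Measurable (Function.uncurry q))
    (hq_pos : ∀ s z, 0 < q s z)
    (hq_int : ∀ s, ∫⁻ z, ENNReal.ofReal (q s z) ∂lam = 1)
    (m0 : Z → ℝ) (hm0_meas : Measurable m0) (hm0_pos : ∀ z, 0 < m0 z)
    (hm0_int : ∫⁻ z, ENNReal.ofReal (m0 z) ∂lam ≤ 1)
    (hlow : ∀ s z, m0 z ≤ q s z)
    (hhigh : ∀ s z, q s z ≤ Real.exp (2 * ε) * m0 z)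
    (Pp Pm : Measure S) [IsProbabilityMeasure Pp] [IsProbabilityMeasure Pm]
    (mp mm : Z → ℝ)
    (hmp : ∀ z, mp z = ∫ s, q s z ∂Pp) (hmm : ∀ z, mm z = ∫ s, q s z ∂Pm) :
    ∫⁻ z, ENNReal.ofReal ((mp z - mm z) * Real.log (mp z / mm z)) ∂lam
      ≤ ENNReal.ofReal (4 * (Real.exp (2 * ε) - 1) ^ 2 *
          (⨆ A : {A : Set S // MeasurableSet A}, |(Pp A).toReal - (Pm A).toReal|) ^ 2) := by
  set T : ℝ := ⨆ A : {A : Set S // MeasurableSet A}, |(Pp A).toReal - (Pm A).toReal| with hT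
  set c : ℝ := Real.exp (2 * ε) - 1 with hc
  have hc0 : 0 ≤ c := sub_nonneg.2 (Real.one_le_exp (by positivity))
  have hmeas (z : Z) : Measurable fun s ↦ q s z := hq_meas.comp measurable_prodMk_right
  have hint (μ : Measure S) [IsProbabilityMeasure μ] (z : Z) :
      Integrable (fun s ↦ q s z) μ :=
    Integrable.of_bound (hmeas z).aestronglyMeasurable (Real.exp (2 * ε) * m0 z)
      (.of_forall fun s ↦ by rw [Real.norm_of_nonneg (hq_pos s z).le]; exact hhigh s z)
  have hge (μ : Measure S) [IsProbabilityMeasure μ] (z : Z) : m0 z ≤ ∫ s, q s z ∂μ := by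
    simpa using integral_mono (integrable_const (m0 z)) (hint μ z) fun s ↦ hlow s z
  have hdiff (z : Z) : |mp z - mm z| ≤ c * m0 z * T := by
    have h := abs_integral_sub_le_mul_iSup Pp Pm ((hmeas z).sub_const (m0 z))
      (mul_nonneg hc0 (hm0_pos z).le) (fun s ↦ sub_nonneg.2 (hlow s z))
      (fun s ↦ by rw [hc]; linarith [hhigh s z])
    rw [integral_sub (hint Pp z) (integrable_const _),
      integral_sub (hint Pm z) (integrable_const _)] at h
    simpa [hmp, hmm] using h
  have hpt (z : Z) : (mp z - mm z) * Real.log (mp z / mm z) ≤ c ^ 2 * T ^ 2 * m0 z := by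
    have hm := hm0_pos z
    refine (sub_mul_log_div_le hm (hmp z ▸ hge Pp z) (hmm z ▸ hge Pm z)).trans ?_
    rw [div_le_iff₀ hm, ← sq_abs]
    calc |mp z - mm z| ^ 2 ≤ (c * m0 z * T) ^ 2 := by gcongr; exact hdiff z
      _ = c ^ 2 * T ^ 2 * m0 z * m0 z := by ring
  calc ∫⁻ z, ENNReal.ofReal ((mp z - mm z) * Real.log (mp z / mm z)) ∂lam
      ≤ ∫⁻ z, ENNReal.ofReal (c ^ 2 * T ^ 2) * ENNReal.ofReal (m0 z) ∂lam :=
        lintegral_mono fun z ↦ by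
          rw [← ENNReal.ofReal_mul (by positivity)]
          exact ENNReal.ofReal_le_ofReal (hpt z)
    _ = ENNReal.ofReal (c ^ 2 * T ^ 2) * ∫⁻ z, ENNReal.ofReal (m0 z) ∂lam :=
        lintegral_const_mul _ hm0_meas.ennreal_ofReal
    _ ≤ ENNReal.ofReal (c ^ 2 * T ^ 2) := mul_le_of_le_one_right' hm0_int
    _ ≤ ENNReal.ofReal (4 * c ^ 2 * T ^ 2) :=
        ENNReal.ofReal_le_ofReal (by nlinarith [mul_nonneg (sq_nonneg c) (sq_nonneg T)])
end
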